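/- Let ψ₁ : ℝ → ℝ be continuously differentiable and supported in [−1/2, 1/2], and let ψ₂ : ℝ → ℝ be bounded measurable and supported in [−1/2, 1/2]. Let K₁, K₂ > 0, let I := [−K₁/2, K₁/2), J := [−K₂/2, K₂/2), and define Ψ(x,y) := (K₁K₂)^{−1/2} · ψ₁(x/K₂) · ψ₂(y/K₁). Then |⟨Ψ, h_{I×J}⟩| ≤ ‖ψ₁′‖_∞ · ‖ψ₂‖_∞ · (K₁/K₂). -/

import Mathlib

open MeasureTheory Set
open scoped ENNReal NNReal

noncomputable section

/-- L²-normalized Haar wavelet of the interval `[a, b)`. -/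
def haarW (a b : ℝ) (x : ℝ) : ℝ :=
  (Real.sqrt (b - a))⁻¹ *
    ((Ico a ((a + b) / 2)).indicator 1 x - (Ico ((a + b) / 2) b).indicator 1 x)

/-- Haar coefficient of `F : ℝ² → ℝ` on the rectangle `[a,b) × [c,d)`. -/
def haarCoef2 (F : ℝ × ℝ → ℝ) (a b c d : ℝ) : ℝ :=
  ∫ p : ℝ × ℝ, F p * (haarW a b p.1 * haarW c d p.2)

/-- Left endpoint of the dyadic interval `2^k • [j, j+1)`. -/
def dyadL (k j : ℤ) : ℝ := (2:ℝ) ^ k * (j : ℝ)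

/-- Right endpoint of the dyadic interval `2^k • [j, j+1)`. -/
def dyadR (k j : ℤ) : ℝ := (2:ℝ) ^ k * ((j : ℝ) + 1)

lemma measurable_haarW (a b : ℝ) : Measurable (haarW a b) := by
  unfold haarW
  exact ((measurable_one.indicator measurableSet_Ico).sub
    (measurable_one.indicator measurableSet_Ico)).const_mul _

lemma abs_haarW_le (a b x : ℝ) :
    |haarW a b x| ≤ (Ico a b).indicator (fun _ => (Real.sqrt (b - a))⁻¹) x := by
  have h0 : 0 ≤ (Real.sqrt (b - a))⁻¹ := by positivity
  simp only [haarW, indicator_apply, mem_Ico, Pi.one_apply, abs_mul, abs_of_nonneg h0]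
  split_ifs <;> first | (exfalso; grind) | simp

lemma integrable_haarW (a b : ℝ) : Integrable (haarW a b) := by
  refine Integrable.mono' (g := (Ico a b).indicator (fun _ => (Real.sqrt (b - a))⁻¹)) ?_
    (measurable_haarW a b).aestronglyMeasurable (.of_forall fun x => abs_haarW_le a b x)
  exact (integrable_indicator_iff measurableSet_Ico).2 (integrableOn_const (by simp))

lemma integral_haarW {a b : ℝ} (hab : a ≤ b) : ∫ x, haarW a b x = 0 := by
  have hi (c d : ℝ) : Integrable ((Ico c d).indicator (1 : ℝ → ℝ)) :=
    (integrable_indicator_iff measurableSet_Ico).2 (integrableOn_const (C := (1 : ℝ)) (by simp))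
  unfold haarW
  rw [integral_const_mul, integral_sub (hi _ _) (hi _ _),
    integral_indicator_one measurableSet_Ico, integral_indicator_one measurableSet_Ico,
    Real.volume_real_Ico_of_le (by linarith), Real.volume_real_Ico_of_le (by linarith)]
  ring

/-- Size estimate for Haar coefficients of a function bounded on the interval. -/
lemma abs_integral_mul_haarW_le {f : ℝ → ℝ} {a b M : ℝ} (hab : a ≤ b)
    (hf : ∀ x ∈ Ico a b, |f x| ≤ M) :
    |∫ x, f x * haarW a b x| ≤ M * Real.sqrt (b - a) := by
  have hg : Integrable ((Ico a b).indicator fun _ => M * (Real.sqrt (b - a))⁻¹) :=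
    (integrable_indicator_iff measurableSet_Ico).2 (integrableOn_const (by simp))
  rw [← Real.norm_eq_abs]
  refine (norm_integral_le_of_norm_le hg (.of_forall fun x => ?_)).trans_eq ?_
  · have h := abs_haarW_le a b x
    rw [Real.norm_eq_abs, abs_mul]
    by_cases hx : x ∈ Ico a b
    · simp only [indicator_of_mem hx] at h ⊢
      exact mul_le_mul (hf x hx) h (abs_nonneg _) ((abs_nonneg _).trans (hf x hx))
    · simp only [indicator_of_notMem hx] at h ⊢
      rw [le_antisymm h (abs_nonneg _), mul_zero]
  · rw [integral_indicator_const (M * (Real.sqrt (b - a))⁻¹) measurableSet_Ico,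
      Real.volume_real_Ico_of_le hab, smul_eq_mul,
      mul_left_comm, ← div_eq_mul_inv, Real.div_sqrt]

/-- Cancellation estimate for Haar coefficients of a function close to a constant on the
interval. -/
lemma abs_integral_mul_haarW_le_of_sub {f : ℝ → ℝ} {a b M c : ℝ} (hab : a ≤ b)
    (hm : Measurable f) (hf : ∀ x ∈ Ico a b, |f x - c| ≤ M) :
    |∫ x, f x * haarW a b x| ≤ M * Real.sqrt (b - a) := by
  have hint : Integrable fun x => (f x - c) * haarW a b x := by
    refine Integrable.mono' ((integrable_haarW a b).norm.const_mul M)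
      ((hm.sub_const c).mul (measurable_haarW a b)).aestronglyMeasurable (.of_forall fun x => ?_)
    rw [norm_mul]
    by_cases hx : x ∈ Ico a b
    · exact mul_le_mul_of_nonneg_right (hf x hx) (norm_nonneg _)
    · have h := abs_haarW_le a b x
      rw [indicator_of_notMem hx] at h
      simp [abs_nonpos_iff.1 h]
  have key : ∫ x, f x * haarW a b x = ∫ x, (f x - c) * haarW a b x := by
    calc ∫ x, f x * haarW a b x
        = ∫ x, ((f x - c) * haarW a b x + c * haarW a b x) := by
          congr 1 with x; ring
      _ = ∫ x, (f x - c) * haarW a b x := by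
          rw [integral_add hint ((integrable_haarW a b).const_mul c), integral_const_mul,
            integral_haarW hab, mul_zero, add_zero]
  rw [key]
  exact abs_integral_mul_haarW_le hab hf

/-- The Haar coefficient of a tensor product factorizes. -/
lemma haarCoef2_mul (f g : ℝ → ℝ) (a b c d : ℝ) :
    haarCoef2 (fun q => f q.1 * g q.2) a b c d =
      (∫ x, f x * haarW a b x) * ∫ y, g y * haarW c d y := by
  rw [haarCoef2, ← integral_prod_mul, ← Measure.volume_eq_prod]
  congr 1 with p
  ring

/-- The estimate (5.4) of Section 5 of the paper: testing a 90°-rotated L²-normalized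
bump adapted to the rectangle `K₁ × K₂` against the Haar wavelet of the original
rectangle gains the eccentricity factor `K₁/K₂`. -/
theorem rotated_bump_eccentricity_gain (ψ₁ ψ₂ : ℝ → ℝ)
    (hψ₁ : ContDiff ℝ 1 ψ₁) (hs₁ : Function.support ψ₁ ⊆ Icc (-(1/2)) (1/2))
    (hψ₂ : Measurable ψ₂) (hs₂ : Function.support ψ₂ ⊆ Icc (-(1/2)) (1/2))
    (M₁ M₂ : ℝ) (hM₁ : ∀ x : ℝ, |deriv ψ₁ x| ≤ M₁) (hM₂ : ∀ y : ℝ, |ψ₂ y| ≤ M₂)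
    (K₁ K₂ : ℝ) (hK₁ : 0 < K₁) (hK₂ : 0 < K₂) :
    |haarCoef2 (fun q : ℝ × ℝ => (Real.sqrt (K₁ * K₂))⁻¹ * ψ₁ (q.1 / K₂) * ψ₂ (q.2 / K₁))
        (-(K₁/2)) (K₁/2) (-(K₂/2)) (K₂/2)| ≤ M₁ * M₂ * (K₁ / K₂) := by
  have hM₁0 : 0 ≤ M₁ := (abs_nonneg _).trans (hM₁ 0)
  have hlip (x : ℝ) : |ψ₁ x - ψ₁ 0| ≤ M₁ * |x| := by
    simpa using convex_univ.norm_image_sub_le_of_norm_deriv_le (f := ψ₁) (x := 0) (y := x)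
      (fun z _ => (hψ₁.differentiable one_ne_zero) z) (fun z _ => hM₁ z) (mem_univ _) (mem_univ _)
  have hA : |∫ x, ψ₁ (x / K₂) * haarW (-(K₁ / 2)) (K₁ / 2) x| ≤
      M₁ * (K₁ / K₂) * Real.sqrt K₁ := by
    have h := abs_integral_mul_haarW_le_of_sub (f := fun x => ψ₁ (x / K₂)) (c := ψ₁ 0)
      (a := -(K₁ / 2)) (b := K₁ / 2) (M := M₁ * (K₁ / K₂)) (by linarith)
      (hψ₁.continuous.measurable.comp (measurable_id.div_const K₂)) fun x hx => by
        refine (hlip _).trans (mul_le_mul_of_nonneg_left ?_ hM₁0)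
        rw [abs_div, abs_of_pos hK₂]
        gcongr
        exact abs_le.2 ⟨by linarith [hx.1], by linarith [hx.2]⟩
    rwa [sub_neg_eq_add, add_halves] at h
  have hB : |∫ y, ψ₂ (y / K₁) * haarW (-(K₂ / 2)) (K₂ / 2) y| ≤ M₂ * Real.sqrt K₂ := by
    have h := abs_integral_mul_haarW_le (f := fun y => ψ₂ (y / K₁))
      (a := -(K₂ / 2)) (b := K₂ / 2) (by linarith) fun y _ => hM₂ (y / K₁)
    rwa [sub_neg_eq_add, add_halves] at h
  rw [haarCoef2_mul (fun x => (Real.sqrt (K₁ * K₂))⁻¹ * ψ₁ (x / K₂)) (fun y => ψ₂ (y / K₁))]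
  simp only [mul_assoc (Real.sqrt (K₁ * K₂))⁻¹]
  rw [integral_const_mul, mul_assoc, abs_mul, abs_mul, abs_of_nonneg (by positivity),
    Real.sqrt_mul hK₁.le]
  have h₁ := Real.sqrt_pos.2 hK₁
  have h₂ := Real.sqrt_pos.2 hK₂
  calc _ ≤ (Real.sqrt K₁ * Real.sqrt K₂)⁻¹ *
        (M₁ * (K₁ / K₂) * Real.sqrt K₁ * (M₂ * Real.sqrt K₂)) := by gcongr
    _ = M₁ * M₂ * (K₁ / K₂) := by field_simp
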